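/- Let E be a finite-dimensional real inner product space, let U and V be subspaces of E, and set W = U \cap V. Let \eta \in W and w \in E. Suppose v = P_V w + n_2 + t_2 with n_2 \in V^\perp and t_2 \in V, and w' = P_U v + n_1 + t_1 with n_1 \in U^\perp and t_1 \in U. Then the following two identities hold: (normal component) P_{W^\perp}(w' - \eta) = P_{W^\perp}\big( P_U\big( P_V\big( P_{W^\perp}(w - \eta) \big) \big) \big) + P_{W^\perp}\big( t_1 + n_1 + P_U(t_2 + n_2) \big); (tangential component) P_W(w' - \eta) = P_W(w - \eta) + P_W(t_1 + t_2). -/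

import Mathlib

open Submodule

variable {E : Type*} [NormedAddCommGroup E] [InnerProductSpace ℝ E] [FiniteDimensional ℝ E]

/-- The orthogonal projection of `E` onto a subspace `W`, as a continuous linear map `E →L[ℝ] E`. -/
noncomputable def projL (W : Submodule ℝ E) : E →L[ℝ] E :=
  W.subtypeL.comp (orthogonalProjection W)

theorem projL_eq_starProjection (W : Submodule ℝ E) : projL W = W.starProjection := rfl

theorem projL_eq_self {W : Submodule ℝ E} {x : E} (hx : x ∈ W) : projL W x = x := by
  rw [projL_eq_starProjection]
  exact starProjection_eq_self_iff.mpr hx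

theorem projL_eq_zero {W : Submodule ℝ E} {x : E} (hx : x ∈ Wᗮ) : projL W x = 0 := by
  rw [projL_eq_starProjection]
  exact (starProjection_apply_eq_zero_iff W).mpr hx

theorem projL_mem (W : Submodule ℝ E) (x : E) : projL W x ∈ W := (orthogonalProjectionOnto W x).2

theorem projL_orthogonal (W : Submodule ℝ E) (x : E) : projL Wᗮ x = x - projL W x := by
  simp only [projL_eq_starProjection]
  exact starProjection_orthogonal_val x

theorem projL_projL_of_le {W U : Submodule ℝ E} (h : W ≤ U) (x : E) :
    projL W (projL U x) = projL W x := by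
  have hx : projL Uᗮ x ∈ Wᗮ := orthogonal_le h (projL_mem _ x)
  rw [projL_orthogonal] at hx
  have := projL_eq_zero hx
  rw [map_sub, sub_eq_zero] at this
  exact this.symm

/-- One-step error recursion for an inexact alternating-projection step.
With `W = U ⊓ V`, `η ∈ W`, `v = P_V w + n₂ + t₂` (`n₂ ∈ Vᗮ`, `t₂ ∈ V`) and
`w' = P_U v + n₁ + t₁` (`n₁ ∈ Uᗮ`, `t₁ ∈ U`), the normal and tangential components of the
error `w' - η` satisfy the stated identities. -/
theorem alternating_error_recursion (U V : Submodule ℝ E)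
    (η w v w' n₁ t₁ n₂ t₂ : E)
    (hη : η ∈ U ⊓ V)
    (hn₂ : n₂ ∈ Vᗮ) (ht₂ : t₂ ∈ V)
    (hn₁ : n₁ ∈ Uᗮ) (ht₁ : t₁ ∈ U)
    (hv : v = projL V w + n₂ + t₂)
    (hw' : w' = projL U v + n₁ + t₁) :
    projL (U ⊓ V)ᗮ (w' - η) =
        projL (U ⊓ V)ᗮ (projL U (projL V (projL (U ⊓ V)ᗮ (w - η)))) +
          projL (U ⊓ V)ᗮ (t₁ + n₁ + projL U (t₂ + n₂)) ∧
    projL (U ⊓ V) (w' - η) = projL (U ⊓ V) (w - η) + projL (U ⊓ V) (t₁ + t₂) := by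
  have hWU : U ⊓ V ≤ U := inf_le_left
  have hWV : U ⊓ V ≤ V := inf_le_right
  have hp := projL_mem (U ⊓ V) (w - η)
  subst hw' hv
  constructor
  · have hV : projL V (projL (U ⊓ V)ᗮ (w - η)) = projL V w - (η + projL (U ⊓ V) (w - η)) := by
      rw [projL_orthogonal, map_sub, map_sub, projL_eq_self (hWV hη), projL_eq_self (hWV hp)]
      abel
    have hz : η + projL (U ⊓ V) (w - η) ∈ U ⊓ V := add_mem hη hp
    have hperp {z : E} (h : z ∈ U ⊓ V) : projL (U ⊓ V)ᗮ z = 0 :=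
      projL_eq_zero (le_orthogonal_orthogonal _ h)
    rw [hV, map_sub (projL U), projL_eq_self (hWU hz), map_sub _ _ (η + _), hperp hz,
      map_sub _ _ η, hperp hη]
    simp only [map_add]
    abel
  · simp only [map_add, map_sub, projL_projL_of_le hWU, projL_projL_of_le hWV,
      projL_eq_zero (orthogonal_le hWU hn₁), projL_eq_zero (orthogonal_le hWV hn₂)]
    abel
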